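/- Let n be a positive integer, let G be a subgroup of the symmetric group S_n acting on ℚ[x_1,...,x_n] by permuting the variables, and let e_1,...,e_n be the elementary symmetric polynomials. Then the quotient ℚ[x_1,...,x_n]/(e_1,...,e_n), with its induced G-action, is isomorphic as a module over the group algebra ℚ[G] to the direct sum of n!/|G| copies of the regular representation of G. -/

import Mathlib

open MvPolynomial Nat

open scoped Pointwise in
theorem span_bound (n : ℕ) : ∀ {R : Type*} {A : Type*} [CommRing R] [CommRing A] [Algebra R A]
    (f : Polynomial R) (a : Fin n → A),
    f.Monic → f.natDegree = n →
    f.map (algebraMap R A) = ∏ i, (Polynomial.X - Polynomial.C (a i)) →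
    Algebra.adjoin R (Set.range a) = ⊤ →
    ∃ s : Finset A, s.card ≤ n ! ∧ Submodule.span R (s : Set A) = ⊤ := by
  classical
  induction n with
  | zero =>
    intro R A _ _ _ f a hf hd hp ha
    refine ⟨{1}, by simp, ?_⟩
    have : Set.range a = ∅ := Set.range_eq_empty a
    rw [this, Algebra.adjoin_empty] at ha
    rw [Finset.coe_singleton, ← Submodule.one_eq_span, ← Algebra.toSubmodule_bot, ha,
      Algebra.top_toSubmodule]
  | succ n ih =>
    intro R A _ _ _ f a hf hd hp ha
    have h0 : f.eval₂ (algebraMap R A) (a 0) = 0 := by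
      rw [← Polynomial.eval_map, hp, Polynomial.eval_prod]
      exact Finset.prod_eq_zero (Finset.mem_univ 0) (by simp)
    let _ : Algebra (AdjoinRoot f) A := (AdjoinRoot.lift (algebraMap R A) (a 0) h0).toAlgebra
    have hroot : algebraMap (AdjoinRoot f) A (AdjoinRoot.root f) = a 0 := AdjoinRoot.lift_root h0
    have : IsScalarTower R (AdjoinRoot f) A := IsScalarTower.of_algebraMap_eq' (by
      exact (AdjoinRoot.lift_comp_of (i := algebraMap R A) (a := a 0) h0).symm)
    have hr : (f.map (algebraMap R (AdjoinRoot f))).IsRoot (AdjoinRoot.root f) := 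
      AdjoinRoot.isRoot_root f
    obtain ⟨g, hg⟩ := Polynomial.dvd_iff_isRoot.mpr hr
    have hfm : (f.map (algebraMap R (AdjoinRoot f))).Monic := hf.map _
    have hgm : g.Monic := by
      rw [hg] at hfm
      exact (Polynomial.monic_X_sub_C _).of_mul_monic_left hfm
    have key : g.map (algebraMap (AdjoinRoot f) A) =
        ∏ i, (Polynomial.X - Polynomial.C (a (Fin.succ i))) := by
      have := congrArg (Polynomial.map (algebraMap (AdjoinRoot f) A)) hg
      rw [Polynomial.map_map, ← IsScalarTower.algebraMap_eq, hp, Fin.prod_univ_succ,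
        Polynomial.map_mul, Polynomial.map_sub, Polynomial.map_X, Polynomial.map_C, hroot] at this
      exact ((Polynomial.monic_X_sub_C (a 0)).isRegular.left this).symm
    by_cases hA : Nontrivial A
    swap
    · rw [not_nontrivial_iff_subsingleton] at hA
      exact ⟨∅, by simp, Subsingleton.elim _ _⟩
    have hgd : g.natDegree = n := by
      rw [← hgm.natDegree_map (algebraMap (AdjoinRoot f) A), key]
      simp
    have hadj : Algebra.adjoin (AdjoinRoot f) (Set.range fun i : Fin n => a i.succ) = ⊤ := by
      rw [eq_top_iff]
      have : (Algebra.adjoin R (Set.range a)) ≤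
        (Algebra.adjoin (AdjoinRoot f) (Set.range fun i : Fin n => a i.succ)).restrictScalars R := by
        rw [Algebra.adjoin_le_iff]
        rintro _ ⟨i, rfl⟩
        refine Fin.cases ?_ (fun i => ?_) i
        · rw [← hroot]
          exact Subalgebra.algebraMap_mem (Algebra.adjoin (AdjoinRoot f)
            (Set.range fun i : Fin n => a i.succ)) (AdjoinRoot.root f)
        · have h : a i.succ ∈ Algebra.adjoin (AdjoinRoot f) (Set.range fun i : Fin n => a i.succ) :=
            Algebra.subset_adjoin (Set.mem_range_self i)
          exact h
      intro x _
      exact this (ha ▸ Algebra.mem_top)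
    obtain ⟨t, htc, ht⟩ := ih g _ hgm hgd key hadj
    let pb := AdjoinRoot.powerBasis' hf
    let s : Finset (AdjoinRoot f) := Finset.univ.image pb.basis
    have hs : Submodule.span R (s : Set (AdjoinRoot f)) = ⊤ := by
      simp only [s, Finset.coe_image, Finset.coe_univ, Set.image_univ]
      exact pb.basis.span_eq
    refine ⟨s • t, ?_, ?_⟩
    · calc (s • t).card ≤ s.card * t.card := Finset.card_smul_le
        _ ≤ (n+1) * n ! := by
          refine Nat.mul_le_mul ?_ htc
          refine Finset.card_image_le.trans ?_
          simp [pb, hd]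
        _ = _ := rfl
    · rw [Finset.coe_smul, Submodule.span_smul_of_span_eq_top hs, ht, Submodule.restrictScalars_top]

noncomputable abbrev coinvI (n : ℕ) : Ideal (MvPolynomial (Fin n) ℚ) :=
  Ideal.span (Set.range fun k : Fin n => esymm (Fin n) ℚ ((k : ℕ) + 1))

theorem esymm_hom (n k : ℕ) : (esymm (Fin n) ℚ k).IsHomogeneous k := by
  unfold esymm
  refine IsHomogeneous.sum _ _ _ fun s hs => ?_
  have := IsHomogeneous.prod s (fun i => (X i : MvPolynomial (Fin n) ℚ)) (fun _ => 1)
    (fun i _ => isHomogeneous_X _ _)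
  simpa [(Finset.mem_powersetCard.mp hs).2] using this

theorem finrank_coinv (n : ℕ) : FiniteDimensional ℚ (MvPolynomial (Fin n) ℚ ⧸ coinvI n) ∧
    Module.finrank ℚ (MvPolynomial (Fin n) ℚ ⧸ coinvI n) ≤ n ! := by
  obtain ⟨s, hs, hs'⟩ := span_bound n (R := ℚ) (A := MvPolynomial (Fin n) ℚ ⧸ coinvI n)
    (Polynomial.X ^ n) (fun i => - Ideal.Quotient.mk (coinvI n) (X i))
    (Polynomial.monic_X_pow n) (Polynomial.natDegree_X_pow n) (by
      have h := MvPolynomial.prod_C_add_X_eq_sum_esymm (R := ℚ) (σ := Fin n)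
      have h := congrArg (Polynomial.map (Ideal.Quotient.mk (coinvI n))) h
      rw [Polynomial.map_prod, Polynomial.map_sum] at h
      simp only [Polynomial.map_add, Polynomial.map_X, Polynomial.map_C, Polynomial.map_mul,
        Polynomial.map_pow] at h
      rw [Finset.sum_range_succ'] at h
      simp only [Polynomial.map_pow, Polynomial.map_X, map_neg, sub_neg_eq_add]
      rw [h, Finset.sum_eq_zero]
      · simp
      · intro i hi
        have : Ideal.Quotient.mk (coinvI n) (esymm (Fin n) ℚ (i+1)) = 0 := by
          rw [Ideal.Quotient.eq_zero_iff_mem]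
          exact Ideal.subset_span ⟨⟨i, by simpa using hi⟩, rfl⟩
        rw [this]; simp) (by
      rw [eq_top_iff]
      intro x _
      obtain ⟨p, rfl⟩ := Ideal.Quotient.mk_surjective x
      induction p using MvPolynomial.induction_on with
      | C a => exact Subalgebra.algebraMap_mem _ a
      | add p q hp hq => 
        rw [map_add]; exact add_mem (hp trivial) (hq trivial)
      | mul_X p i hp =>
        rw [map_mul]
        refine mul_mem (hp trivial) ?_
        rw [← neg_neg (Ideal.Quotient.mk (coinvI n) (X i))]
        exact neg_mem (Algebra.subset_adjoin ⟨i, rfl⟩))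
  refine ⟨⟨⟨s, hs'⟩⟩, ?_⟩
  rw [← finrank_top, ← hs']
  exact (finrank_span_finset_le_card s).trans hs

/-- evaluation at permuted points -/
noncomputable def Ev (n : ℕ) : MvPolynomial (Fin n) ℚ →ₗ[ℚ] (Equiv.Perm (Fin n) → ℚ) :=
  LinearMap.pi fun σ => (aeval (fun i => ((σ i : ℕ) : ℚ))).toLinearMap

theorem Ev_apply (n : ℕ) (p) (σ) : Ev n p σ = aeval (fun i => ((σ i : ℕ) : ℚ)) p := rfl

theorem Ev_rename (n : ℕ) (p) (g σ : Equiv.Perm (Fin n)) :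
    Ev n (rename g p) σ = Ev n p (σ * g) := by
  rw [Ev_apply, Ev_apply, aeval_rename]; rfl

theorem Ev_surj (n : ℕ) : Function.Surjective (Ev n) := by
  classical
  rw [← LinearMap.range_eq_top, eq_top_iff, ← (Pi.basisFun ℚ (Equiv.Perm (Fin n))).span_eq,
    Submodule.span_le]
  rintro _ ⟨σ, rfl⟩
  let P : MvPolynomial (Fin n) ℚ :=
    ∏ i, ∏ m ∈ Finset.univ.erase (σ i), (X i - C ((m : ℕ) : ℚ))
  have h1 : Ev n P σ ≠ 0 := by
    simp only [Ev_apply, P, map_prod, map_sub, aeval_X, aeval_C]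
    refine Finset.prod_ne_zero_iff.mpr fun i _ => Finset.prod_ne_zero_iff.mpr fun m hm => ?_
    have := (Finset.mem_erase.mp hm).1
    simp only [Algebra.algebraMap_self, RingHom.id_apply, ne_eq, sub_eq_zero, Nat.cast_inj]
    exact fun h => this (Fin.ext h.symm)
  have h2 : ∀ τ, τ ≠ σ → Ev n P τ = 0 := by
    intro τ hτ
    obtain ⟨i, hi⟩ : ∃ i, τ i ≠ σ i := by
      by_contra! h
      exact hτ (Equiv.ext h)
    simp only [Ev_apply, P, map_prod, map_sub, aeval_X, aeval_C]
    refine Finset.prod_eq_zero (Finset.mem_univ i) (Finset.prod_eq_zero (i := τ i) (by simp [hi]) ?_)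
    simp
  refine ⟨(Ev n P σ)⁻¹ • P, ?_⟩
  ext τ
  rw [map_smul, Pi.smul_apply, Pi.basisFun_apply]
  by_cases h : τ = σ
  · subst h; simp [h1]
  · simp [h2 τ h, h]

theorem Ev_mul_esymm (n k : ℕ) (p) :
    Ev n (p * esymm (Fin n) ℚ k) = (Ev n (esymm (Fin n) ℚ k) 1) • Ev n p := by
  ext σ
  have : Ev n (esymm (Fin n) ℚ k) σ = Ev n (esymm (Fin n) ℚ k) 1 := by
    conv_rhs => rw [← rename_esymm (Fin n) ℚ k σ]
    rw [Ev_rename, one_mul]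
  rw [← this, Pi.smul_apply, smul_eq_mul, mul_comm]
  simp only [Ev_apply, map_mul]

theorem comp_mem_aux (n : ℕ) (k : Fin n) (c : MvPolynomial (Fin n) ℚ) (m : ℕ) :
    homogeneousComponent m (c * esymm (Fin n) ℚ (k + 1)) ∈ coinvI n ∧
      Ev n (homogeneousComponent m (c * esymm (Fin n) ℚ (k + 1))) ∈
      Submodule.span ℚ (Ev n '' {a | a.totalDegree < m}) := by
  induction c using MvPolynomial.induction_on' with
  | add p q hp hq =>
    rw [add_mul, map_add, map_add]
    exact ⟨add_mem hp.1 hq.1, add_mem hp.2 hq.2⟩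
  | monomial u a =>
    have h1 : (monomial u a : MvPolynomial (Fin n) ℚ).IsHomogeneous u.degree :=
      isHomogeneous_monomial a rfl
    have h2 := h1.mul (esymm_hom n (k+1))
    rw [homogeneousComponent_of_mem h2]
    split_ifs with h
    · refine ⟨Ideal.mul_mem_left _ _ (Ideal.subset_span ⟨k, rfl⟩), ?_⟩
      rw [Ev_mul_esymm]
      refine Submodule.smul_mem _ _ (Submodule.subset_span ⟨_, ?_, rfl⟩)
      have := h1.totalDegree_le
      simp only [Set.mem_ofPred_eq]
      omega
    · simp

theorem comp_mem (n : ℕ) (q) (hq : q ∈ coinvI n) (m : ℕ) :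
    homogeneousComponent m q ∈ coinvI n ∧ Ev n (homogeneousComponent m q) ∈
      Submodule.span ℚ (Ev n '' {a | a.totalDegree < m}) := by
  obtain ⟨c, rfl⟩ := Ideal.mem_span_range_iff_exists_fun.mp hq
  rw [map_sum, map_sum]
  exact ⟨sum_mem fun i _ => (comp_mem_aux n i (c i) m).1,
    sum_mem fun i _ => (comp_mem_aux n i (c i) m).2⟩

theorem rename_mem (n : ℕ) (σ : Equiv.Perm (Fin n)) (q) (hq : q ∈ coinvI n) :
    rename σ q ∈ coinvI n := by
  obtain ⟨c, rfl⟩ := Ideal.mem_span_range_iff_exists_fun.mp hq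
  rw [map_sum]
  refine sum_mem fun i _ => ?_
  rw [map_mul, rename_esymm]
  exact Ideal.mul_mem_left _ _ (Ideal.subset_span ⟨i, rfl⟩)

theorem exists_P (n : ℕ) : ∃ P : MvPolynomial (Fin n) ℚ →ₗ[ℚ] MvPolynomial (Fin n) ℚ,
    (∀ p, P p ∈ coinvI n) ∧ (∀ p ∈ coinvI n, P p = p) ∧
    (∀ p, (P p).totalDegree ≤ p.totalDegree) := by
  have hπ : ∀ d : ℕ, ∃ π : MvPolynomial (Fin n) ℚ →ₗ[ℚ] MvPolynomial (Fin n) ℚ,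
      (∀ p, π p ∈ coinvI n) ∧ (∀ p, (π p).IsHomogeneous d) ∧
      (∀ p ∈ coinvI n, p.IsHomogeneous d → π p = p) := by
    intro d
    let W : Submodule ℚ (MvPolynomial (Fin n) ℚ) :=
      (coinvI n).restrictScalars ℚ ⊓ homogeneousSubmodule (Fin n) ℚ d
    obtain ⟨g, hg⟩ := W.subtype.exists_leftInverse_of_injective W.ker_subtype
    refine ⟨W.subtype ∘ₗ g, fun p => (g p).2.1, fun p => (g p).2.2, fun p hp hd => ?_⟩
    have := LinearMap.congr_fun hg ⟨p, hp, hd⟩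
    exact congrArg Subtype.val this
  choose π h1 h2 h3 using hπ
  let P : MvPolynomial (Fin n) ℚ →ₗ[ℚ] MvPolynomial (Fin n) ℚ :=
    (basisMonomials (Fin n) ℚ).constr ℚ fun u => π u.degree (monomial u 1)
  have hP : ∀ u, P (monomial u 1) = π u.degree (monomial u 1) := fun u => by
    have := (basisMonomials (Fin n) ℚ).constr_basis ℚ
      (fun u => π u.degree (monomial u 1)) u
    rwa [coe_basisMonomials] at this
  have hP' : ∀ p, P p = ∑ u ∈ p.support, p.coeff u • π u.degree (monomial u 1) := fun p => by
    conv_lhs => rw [p.as_sum, map_sum]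
    refine Finset.sum_congr rfl fun u _ => ?_
    rw [← hP, ← map_smul, smul_monomial, smul_eq_mul, mul_one]
  have hPh : ∀ d p, p.IsHomogeneous d → P p = π d p := fun d p hp => by
    rw [hP']
    conv_rhs => rw [p.as_sum, map_sum]
    refine Finset.sum_congr rfl fun u hu => ?_
    have hd : u.degree = d := (hp.degree_eq_sum_deg_support hu).symm
    rw [hd, ← map_smul, smul_monomial, smul_eq_mul, mul_one]
  refine ⟨P, fun p => ?_, fun p hp => ?_, fun p => ?_⟩
  · rw [hP']
    exact sum_mem fun u _ => Submodule.smul_of_tower_mem _ _ (h1 _ _)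
  · conv_lhs => rw [← sum_homogeneousComponent p, map_sum]
    conv_rhs => rw [← sum_homogeneousComponent p]
    refine Finset.sum_congr rfl fun d _ => ?_
    rw [hPh d _ (homogeneousComponent_isHomogeneous d p)]
    exact h3 d _ (comp_mem n p hp d).1 (homogeneousComponent_isHomogeneous d p)
  · rw [hP']
    refine totalDegree_finsetSum_le fun u hu => (totalDegree_smul_le _ _).trans ?_
    exact (h2 _ _).totalDegree_le.trans (le_totalDegree hu)

theorem exists_P' (n : ℕ) : ∃ P : MvPolynomial (Fin n) ℚ →ₗ[ℚ] MvPolynomial (Fin n) ℚ,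
    (∀ p, P p ∈ coinvI n) ∧ (∀ p ∈ coinvI n, P p = p) ∧
    (∀ p, (P p).totalDegree ≤ p.totalDegree) ∧
    (∀ (σ : Equiv.Perm (Fin n)) p, P (rename σ p) = rename σ (P p)) := by
  obtain ⟨P, h1, h2, h3⟩ := exists_P n
  let r (σ : Equiv.Perm (Fin n)) : MvPolynomial (Fin n) ℚ →ₗ[ℚ] MvPolynomial (Fin n) ℚ :=
    (rename σ).toLinearMap
  let Q : MvPolynomial (Fin n) ℚ →ₗ[ℚ] MvPolynomial (Fin n) ℚ :=
    ((n ! : ℚ))⁻¹ • ∑ σ : Equiv.Perm (Fin n), r σ ∘ₗ P ∘ₗ r σ⁻¹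
  have hQ : ∀ p, Q p = ((n ! : ℚ))⁻¹ • ∑ σ : Equiv.Perm (Fin n),
      rename σ (P (rename (σ⁻¹ : Equiv.Perm (Fin n)) p)) := fun p => by
    simp [Q, r, LinearMap.sum_apply]
  have hrr : ∀ (σ τ : Equiv.Perm (Fin n)) (p : MvPolynomial (Fin n) ℚ),
      rename σ (rename τ p) = rename (σ * τ : Equiv.Perm (Fin n)) p := fun σ τ p => by
    rw [rename_rename]; rfl
  have hr1 : ∀ p : MvPolynomial (Fin n) ℚ, rename (1 : Equiv.Perm (Fin n)) p = p := fun p => by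
    rw [Equiv.Perm.coe_one, rename_id_apply]
  refine ⟨Q, fun p => ?_, fun p hp => ?_, fun p => ?_, fun τ p => ?_⟩
  · rw [hQ]
    exact Submodule.smul_of_tower_mem _ _ (sum_mem fun σ _ => rename_mem n σ _ (h1 _))
  · rw [hQ]
    have : ∀ σ : Equiv.Perm (Fin n),
        rename σ (P (rename (σ⁻¹ : Equiv.Perm (Fin n)) p)) = p := fun σ => by
      rw [h2 _ (rename_mem n _ _ hp), hrr, mul_inv_cancel, hr1]
    simp only [this, Finset.sum_const, Finset.card_univ, Fintype.card_perm, Fintype.card_fin]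
    rw [← Nat.cast_smul_eq_nsmul ℚ, smul_smul, inv_mul_cancel₀, one_smul]
    exact_mod_cast Nat.factorial_ne_zero n
  · rw [hQ]
    refine (totalDegree_smul_le _ _).trans (totalDegree_finsetSum_le fun σ _ => ?_)
    exact (totalDegree_rename_le _ _).trans ((h3 _).trans (totalDegree_rename_le _ _))
  · rw [hQ, hQ, map_smul, map_sum]
    congr 1
    refine Fintype.sum_equiv (Equiv.mulLeft τ⁻¹) _ _ fun σ => ?_
    simp only [Equiv.coe_mulLeft]
    rw [hrr, hrr]
    simp

theorem surj (n : ℕ) (P : MvPolynomial (Fin n) ℚ →ₗ[ℚ] MvPolynomial (Fin n) ℚ)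
    (h1 : ∀ p, P p ∈ coinvI n) (h3 : ∀ p, (P p).totalDegree ≤ p.totalDegree) :
    Function.Surjective (Ev n ∘ₗ (LinearMap.id - P)) := by
  have key : ∀ d p, p.totalDegree < d →
      Ev n p ∈ LinearMap.range (Ev n ∘ₗ (LinearMap.id - P)) := by
    intro d
    induction d with
    | zero => intro p hp; omega
    | succ d ih =>
      intro p hp
      have e : Ev n p = (Ev n ∘ₗ (LinearMap.id - P)) p + Ev n (P p) := by simp
      rw [e]
      refine add_mem (LinearMap.mem_range_self _ _) ?_
      rw [← sum_homogeneousComponent (P p), map_sum]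
      refine sum_mem fun m hm => ?_
      refine Submodule.span_le.mpr ?_ (comp_mem n _ (h1 p) m).2
      rintro _ ⟨a, ha, rfl⟩
      refine ih a ?_
      have := h3 p
      simp only [Finset.mem_range, Set.mem_ofPred_eq] at hm ha
      omega
  intro f
  obtain ⟨p, rfl⟩ := Ev_surj n f
  exact key _ p (Nat.lt_succ_self _)

theorem exists_equiv (n : ℕ) :
    ∃ e : (MvPolynomial (Fin n) ℚ ⧸ coinvI n) ≃ₗ[ℚ] (Equiv.Perm (Fin n) → ℚ),
    ∀ (g σ : Equiv.Perm (Fin n)) p, e (Ideal.Quotient.mk (coinvI n) (rename g p)) σ =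
      e (Ideal.Quotient.mk (coinvI n) p) (σ * g) := by
  obtain ⟨P, h1, h2, h3, h4⟩ := exists_P' n
  have hs := surj n P h1 h3
  let F₀ : (MvPolynomial (Fin n) ℚ ⧸ (coinvI n).restrictScalars ℚ) →ₗ[ℚ]
      (Equiv.Perm (Fin n) → ℚ) := Submodule.liftQ _ (Ev n ∘ₗ (LinearMap.id - P)) (by
        intro p hp
        have := h2 p hp
        simp [this])
  let F : (MvPolynomial (Fin n) ℚ ⧸ coinvI n) →ₗ[ℚ] (Equiv.Perm (Fin n) → ℚ) :=
    F₀ ∘ₗ (Submodule.Quotient.restrictScalarsEquiv ℚ (coinvI n)).symm.toLinearMap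
  have hF : ∀ p, F (Ideal.Quotient.mk (coinvI n) p) = Ev n (p - P p) := fun p => rfl
  have hFs : Function.Surjective F := fun f => by
    obtain ⟨p, rfl⟩ := hs f
    exact ⟨_, hF p⟩
  obtain ⟨hfd, hle⟩ := finrank_coinv n
  have hfr : Module.finrank ℚ (MvPolynomial (Fin n) ℚ ⧸ coinvI n) =
      Module.finrank ℚ (Equiv.Perm (Fin n) → ℚ) := by
    refine le_antisymm ?_ (LinearMap.finrank_le_finrank_of_surjective hFs)
    simpa [Fintype.card_perm] using hle
  have hFi : Function.Injective F :=
    (LinearMap.injective_iff_surjective_of_finrank_eq_finrank hfr).mpr hFs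
  refine ⟨LinearEquiv.ofBijective F ⟨hFi, hFs⟩, fun g σ p => ?_⟩
  change F _ σ = F _ (σ * g)
  rw [hF, hF, h4, ← map_sub, Ev_rename]


/-- For a subgroup `G` of `Sₙ` acting on `ℚ[x₁,…,xₙ]` by permuting variables, the coinvariant
ring `ℚ[x₁,…,xₙ]/(e₁,…,eₙ)`, with its induced `G`-action, is isomorphic as a module over the
group algebra `ℚ[G]` (i.e. via a `ℚ`-linear, `G`-equivariant isomorphism) to the direct sum of
`n!/|G|` copies of the regular representation of `G`. -/
theorem coinvariant_ring_isom_regular_reps_of_subgroup (n : ℕ) (hn : 0 < n)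
    (G : Subgroup (Equiv.Perm (Fin n))) :
    ∃ e : (MvPolynomial (Fin n) ℚ ⧸
        Ideal.span (Set.range fun k : Fin n => esymm (Fin n) ℚ ((k : ℕ) + 1))) ≃ₗ[ℚ]
        (Fin (n ! / Nat.card G) → MonoidAlgebra ℚ ↥G),
      ∀ (g : ↥G) (p : MvPolynomial (Fin n) ℚ) (i : Fin (n ! / Nat.card G)),
        e (Ideal.Quotient.mk (Ideal.span (Set.range fun k : Fin n => esymm (Fin n) ℚ ((k : ℕ) + 1)))
            (rename (⇑(g : Equiv.Perm (Fin n))) p)) i =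
          MonoidAlgebra.of ℚ ↥G g *
            e (Ideal.Quotient.mk
                (Ideal.span (Set.range fun k : Fin n => esymm (Fin n) ℚ ((k : ℕ) + 1))) p) i := by
  classical
  obtain ⟨e, he⟩ := exists_equiv n
  have hcard : Nat.card (Equiv.Perm (Fin n) ⧸ G) = n ! / Nat.card G := by
    have h := G.card_eq_card_quotient_mul_card_subgroup
    rw [Nat.card_eq_fintype_card, Fintype.card_perm, Fintype.card_fin] at h
    rw [h, Nat.mul_div_cancel _ Nat.card_pos]
  let ι : (Equiv.Perm (Fin n) ⧸ G) ≃ Fin (n ! / Nat.card G) := Finite.equivFinOfCardEq hcard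
  let ρ : Fin (n ! / Nat.card G) → Equiv.Perm (Fin n) := fun i => (ι.symm i).out
  let m : Fin (n ! / Nat.card G) × G → Equiv.Perm (Fin n) := fun x => ρ x.1 * (x.2 : Equiv.Perm (Fin n))⁻¹
  have hm : Function.Bijective m := by
    constructor
    · rintro ⟨i, g⟩ ⟨j, h⟩ hij
      have hq : ∀ x, (QuotientGroup.mk (m x) : Equiv.Perm (Fin n) ⧸ G) = ι.symm x.1 := by
        intro x
        rw [← QuotientGroup.out_eq' (ι.symm x.1)]
        refine QuotientGroup.eq.mpr ?_
        simp [m, ρ]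
      have h1 := hq (i, g)
      rw [hij, hq] at h1
      have h2 : j = i := ι.symm.injective h1
      subst h2
      simpa [m] using hij
    · intro σ
      have h1 : (QuotientGroup.mk σ : Equiv.Perm (Fin n) ⧸ G) =
          QuotientGroup.mk (ρ (ι σ)) := by
        simp [ρ]
      have h2 := QuotientGroup.eq.mp h1
      refine ⟨(ι σ, ⟨_, h2⟩), ?_⟩
      simp [m]
  let E : (Equiv.Perm (Fin n) → ℚ) ≃ₗ[ℚ] (Fin (n ! / Nat.card G) → MonoidAlgebra ℚ ↥G) :=
    (LinearEquiv.funCongrLeft ℚ ℚ (Equiv.ofBijective m hm)) ≪≫ₗ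
    (LinearEquiv.curry ℚ ℚ _ _) ≪≫ₗ
    LinearEquiv.piCongrRight fun _ =>
      (Finsupp.linearEquivFunOnFinite ℚ ℚ G).symm ≪≫ₗ (MonoidAlgebra.coeffLinearEquiv ℚ).symm
  have hE : ∀ f i (h : G), (E f i).coeff h = f (ρ i * (h : Equiv.Perm (Fin n))⁻¹) := fun f i h => rfl
  refine ⟨e ≪≫ₗ E, fun g p i => ?_⟩
  ext h
  rw [MonoidAlgebra.of_apply, MonoidAlgebra.coeff_single_mul_eq_mul_coeff (m₂ := g⁻¹ * h) (H := by simp [eq_inv_mul_iff_mul_eq]), one_mul]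
  clear_value E
  rw [LinearEquiv.trans_apply, LinearEquiv.trans_apply, hE, hE]
  refine (he _ _ _).trans ?_
  simp [mul_assoc]
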